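/- Structure theorem for the projective Clifford group: there is a surjective group homomorphism pi : PCl' -> Sp(V, omega) (where PCl' carries composition of automorphisms) characterized by: for every gamma in PCl' and every u in V there exists t in ZMod d' with gamma(Delta_(ulift u)) = tau^(t.val) * Delta_(ulift(pi(gamma)(u))). Moreover, the map i sending a ZMod d-linear functional mu : V -> ZMod d to the automorphism i(mu) of P' determined by i(mu)(Delta_v) = zeta^((mu vbar).val) * Delta_v for all v in V' is a well-defined injective group homomorphism from the additive group of linear functionals V* = Hom(V, ZMod d) into PCl', and its range equals the kernel of pi. In particular 1 -> V* -> PCl' -> Sp(V,omega) -> 1 is a short exact sequence of groups. -/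

import Mathlib

noncomputable section

namespace PaperPCl

/-- `d' = 2d` if `d` is even, `d' = d` if `d` is odd. -/
def dp (d : ℕ) : ℕ := if Even d then 2 * d else d

lemma d_dvd_dp (d : ℕ) : d ∣ dp d := by
  unfold dp; split
  · exact dvd_mul_left d 2
  · rfl

/-- The phase space `V = (ZMod d)^n × (ZMod d)^n`, vectors written `(q, p)`. -/
abbrev V (d n : ℕ) := (Fin n → ZMod d) × (Fin n → ZMod d)

/-- Dot product of two vectors in `(ZMod d)^n`. -/
def dotp {d n : ℕ} (p q : Fin n → ZMod d) : ZMod d := ∑ i, p i * q i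

/-- The standard symplectic form `omega((q1,p1),(q2,p2)) = p1·q2 - p2·q1`. -/
def omegaF {d n : ℕ} (v w : V d n) : ZMod d := dotp v.2 w.1 - dotp w.2 v.1

/-- Componentwise reduction mod `d`, `V' → V`. -/
def reduceV (d n : ℕ) (v : V (dp d) n) : V d n :=
  (fun i => ZMod.castHom (d_dvd_dp d) (ZMod d) (v.1 i),
   fun i => ZMod.castHom (d_dvd_dp d) (ZMod d) (v.2 i))

/-- Componentwise `val`-lift `V → V'`. -/
def liftV (d n : ℕ) (u : V d n) : V (dp d) n :=
  (fun i => ((u.1 i).val : ZMod (dp d)), fun i => ((u.2 i).val : ZMod (dp d)))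

/-- `zeta = exp(2 pi i / d)`. -/
def zeta (d : ℕ) : ℂ := Complex.exp (2 * Real.pi * Complex.I / d)

/-- `tau = exp(pi i / d)` if `d` is even, `tau = zeta^((d+1)/2)` if `d` is odd. -/
def tau (d : ℕ) : ℂ :=
  if Even d then Complex.exp (Real.pi * Complex.I / d) else zeta d ^ ((d + 1) / 2)

/-- The Pauli matrix `D_(q,p) = X^q Z^p`, a `d^n × d^n` complex matrix. -/
def Dop (d n : ℕ) [NeZero d] (u : V d n) : Matrix (Fin n → ZMod d) (Fin n → ZMod d) ℂ :=
  fun r s => if r = s + u.1 then zeta d ^ (dotp u.2 s).val else 0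

/-- The displacement operator `Delta_v = tau^(q·p) D_(vbar)` for `v = (q,p) ∈ V'`. -/
def Delta (d n : ℕ) [NeZero d] (v : V (dp d) n) : Matrix (Fin n → ZMod d) (Fin n → ZMod d) ℂ :=
  tau d ^ (dotp v.1 v.2).val • Dop d n (reduceV d n v)

/-- The large Pauli group `P'`: the subgroup of invertible `d^n × d^n` complex matrices
generated by the scalar matrix `tau • 1` together with all `D_u`, `u ∈ V`. -/
def Pgrp (d n : ℕ) [NeZero d] : Subgroup (Matrix (Fin n → ZMod d) (Fin n → ZMod d) ℂ)ˣ :=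
  Subgroup.closure {x | (x : Matrix (Fin n → ZMod d) (Fin n → ZMod d) ℂ)
      = tau d • (1 : Matrix (Fin n → ZMod d) (Fin n → ZMod d) ℂ)
    ∨ ∃ u : V d n, (x : Matrix (Fin n → ZMod d) (Fin n → ZMod d) ℂ) = Dop d n u}

/-- The underlying matrix of an element of `P'`. -/
def matVal {d n : ℕ} [NeZero d] (g : ↥(Pgrp d n)) : Matrix (Fin n → ZMod d) (Fin n → ZMod d) ℂ :=
  ((g : (Matrix (Fin n → ZMod d) (Fin n → ZMod d) ℂ)ˣ) : Matrix (Fin n → ZMod d) (Fin n → ZMod d) ℂ)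

/-- A function `γ : P' → P'` is center-respecting if `γ(z*g) = z*γ(g)`
for every `z` in the center of `P'`. -/
def CenterResp {d n : ℕ} [NeZero d] (γ : ↥(Pgrp d n) → ↥(Pgrp d n)) : Prop :=
  ∀ z ∈ Subgroup.center ↥(Pgrp d n), ∀ g, γ (z * g) = z * γ g

/-- A group automorphism of `P'` is projective Clifford if it fixes the center pointwise. -/
def IsPCl {d n : ℕ} [NeZero d] (γ : ↥(Pgrp d n) ≃* ↥(Pgrp d n)) : Prop :=
  ∀ z ∈ Subgroup.center ↥(Pgrp d n), γ z = z

/-- A linear automorphism is symplectic if it preserves the standard symplectic form. -/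
def IsSymp (d n : ℕ) (ψ : V d n ≃ₗ[ZMod d] V d n) : Prop :=
  ∀ u v : V d n, omegaF (ψ u) (ψ v) = omegaF u v

/-- `b` is a standard basis vector of `V`. -/
def IsStdBasis {d n : ℕ} (b : V d n) : Prop :=
  (∃ i : Fin n, b = (Pi.single i 1, 0)) ∨ (∃ i : Fin n, b = (0, Pi.single i 1))

/-- The symplectic group `Sp(V, omega)` as a subgroup of the group of linear automorphisms. -/
def SpGrp (d n : ℕ) : Subgroup (V d n ≃ₗ[ZMod d] V d n) where
  carrier := {ψ | IsSymp d n ψ}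
  one_mem' := fun _ _ => rfl
  mul_mem' := by
    intro f g hf hg u v
    have h1 : (f * g) u = f (g u) := rfl
    have h2 : (f * g) v = f (g v) := rfl
    rw [h1, h2, hf, hg]
  inv_mem' := by
    intro f hf u v
    have h := hf (f.symm u) (f.symm v)
    rw [LinearEquiv.apply_symm_apply, LinearEquiv.apply_symm_apply] at h
    exact h.symm

/-- The projective Clifford group `PCl'` as a subgroup of `MulAut P'`:
automorphisms of `P'` fixing the center pointwise. -/
def PClGrp (d n : ℕ) [NeZero d] : Subgroup (MulAut ↥(Pgrp d n)) where
  carrier := {γ | ∀ z ∈ Subgroup.center ↥(Pgrp d n), γ z = z}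
  one_mem' := by intro z _; rfl
  mul_mem' := by
    intro a b ha hb z hz
    have h : (a * b) z = a (b z) := rfl
    rw [h, hb z hz, ha z hz]
  inv_mem' := by
    intro a ha z hz
    have h := ha z hz
    calc (a⁻¹ : MulAut ↥(Pgrp d n)) z = a⁻¹ (a z) := by rw [h]
      _ = z := MulEquiv.symm_apply_apply a z

instance (d : ℕ) [NeZero d] : NeZero (dp d) :=
  ⟨by unfold dp; split <;> simp [NeZero.ne d]⟩

/-- Reduction `ZMod d' → ZMod d`. -/
abbrev red (d : ℕ) : ZMod (dp d) →+* ZMod d := ZMod.castHom (d_dvd_dp d) (ZMod d)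

lemma red_natCast_val (d : ℕ) [NeZero d] (x : ZMod d) : red d (x.val : ZMod (dp d)) = x := by
  simp

lemma dp_dvd_two_mul (d : ℕ) : dp d ∣ 2 * d := by
  unfold dp; split
  · rfl
  · exact dvd_mul_left d 2

lemma dp_dvd_mul_self (d : ℕ) : dp d ∣ d * d := by
  unfold dp; split
  · next h => exact Nat.mul_dvd_mul_right h.two_dvd d
  · exact dvd_mul_left d d

lemma exists_eq_mul_of_red_eq_zero {d : ℕ} [NeZero d] {z : ZMod (dp d)} (hz : red d z = 0) :
    ∃ k : ℕ, z = ((d * k : ℕ) : ZMod (dp d)) := by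
  obtain ⟨m, rfl⟩ := ZMod.natCast_zmod_surjective z
  rw [map_natCast, ZMod.natCast_eq_zero_iff] at hz
  obtain ⟨k, rfl⟩ := hz
  exact ⟨k, rfl⟩

lemma two_mul_eq_zero_of_red {d : ℕ} [NeZero d] {z : ZMod (dp d)} (hz : red d z = 0) :
    2 * z = 0 := by
  obtain ⟨k, rfl⟩ := exists_eq_mul_of_red_eq_zero hz
  have h : ((2 * (d * k) : ℕ) : ZMod (dp d)) = 0 := by
    rw [ZMod.natCast_eq_zero_iff, ← mul_assoc]
    exact (dp_dvd_two_mul d).mul_right k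
  exact_mod_cast h

lemma mul_eq_zero_of_red {d : ℕ} [NeZero d] {y z : ZMod (dp d)} (hy : red d y = 0)
    (hz : red d z = 0) : y * z = 0 := by
  obtain ⟨k, rfl⟩ := exists_eq_mul_of_red_eq_zero hy
  obtain ⟨l, rfl⟩ := exists_eq_mul_of_red_eq_zero hz
  rw [← Nat.cast_mul, ZMod.natCast_eq_zero_iff, mul_mul_mul_comm]
  exact (dp_dvd_mul_self d).mul_right _

lemma two_mul_eq_of_red_eq {d : ℕ} [NeZero d] {y z : ZMod (dp d)} (h : red d y = red d z) :
    2 * y = 2 * z := by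
  rw [← sub_eq_zero, ← mul_sub]
  exact two_mul_eq_zero_of_red (by rw [map_sub, h, sub_self])

/-- Multiplication by two, as a map `ZMod d → ZMod d'`. -/
def twice (d : ℕ) [NeZero d] : ZMod d →+ ZMod (dp d) where
  toFun x := 2 * (x.val : ZMod (dp d))
  map_zero' := by simp
  map_add' x y := by
    rw [← mul_add]
    exact two_mul_eq_of_red_eq (by rw [map_add]; simp only [red_natCast_val])

lemma twice_apply {d : ℕ} [NeZero d] (x : ZMod d) : twice d x = 2 * (x.val : ZMod (dp d)) := rfl

lemma twice_red {d : ℕ} [NeZero d] (y : ZMod (dp d)) : twice d (red d y) = 2 * y :=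
  two_mul_eq_of_red_eq (red_natCast_val d _)

lemma twice_injective (d : ℕ) [NeZero d] : Function.Injective (twice d) := by
  rw [injective_iff_map_eq_zero]
  intro x hx
  rw [twice_apply] at hx
  have h : ((2 * x.val : ℕ) : ZMod (dp d)) = 0 := by exact_mod_cast hx
  rw [ZMod.natCast_eq_zero_iff] at h
  have hd : d ∣ x.val := by
    unfold dp at h
    split at h
    · exact Nat.dvd_of_mul_dvd_mul_left two_pos h
    · next ho =>
      exact (Nat.coprime_two_right.mpr (Nat.not_even_iff_odd.mp ho)).dvd_of_dvd_mul_left h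
  rw [← ZMod.natCast_zmod_val x, ZMod.natCast_eq_zero_iff]
  exact hd

lemma exists_twice_eq {d : ℕ} [NeZero d] {y : ZMod (dp d)} (hy : d • y = 0) :
    ∃ x, twice d x = y := by
  obtain ⟨m, rfl⟩ := ZMod.natCast_zmod_surjective y
  rw [nsmul_eq_mul, ← Nat.cast_mul, ZMod.natCast_eq_zero_iff] at hy
  suffices ∃ k : ℕ, ((2 * k : ℕ) : ZMod (dp d)) = m by
    obtain ⟨k, hk⟩ := this
    exact ⟨red d k, by rw [twice_red, ← hk]; push_cast; rfl⟩
  by_cases he : Even d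
  · have hdp : dp d = 2 * d := if_pos he
    rw [hdp, mul_comm 2 d] at hy
    obtain ⟨k, rfl⟩ := Nat.dvd_of_mul_dvd_mul_left (NeZero.pos d) hy
    exact ⟨k, rfl⟩
  · have hdp : dp d = d := if_neg he
    obtain ⟨k, hk⟩ := Nat.not_even_iff_odd.mp he
    refine ⟨(k + 1) * m, ?_⟩
    have h : 2 * ((k + 1) * m) = dp d * m + m := by rw [hdp, hk]; ring
    rw [h]
    simp

/-- Every symmetric bilinear form over `ZMod d` on a finite free module is, after doubling,
the polarization of a function with values in `ZMod d'`. -/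
lemma exists_quadratic_refinement {d : ℕ} [NeZero d] {W ι : Type*} [AddCommGroup W]
    [Module (ZMod d) W] [Fintype ι] (b : Module.Basis ι (ZMod d) W)
    (B : W →ₗ[ZMod d] W →ₗ[ZMod d] ZMod d) (hB : ∀ u v, B u v = B v u) :
    ∃ f : W → ZMod (dp d), ∀ u v, f (u + v) = f u + f v + twice d (B u v) := by
  classical
  let L : ZMod d → ZMod (dp d) := fun x => (x.val : ZMod (dp d))
  have hL : ∀ x, red d (L x) = x := red_natCast_val d
  let C : (ι → ZMod (dp d)) → (ι → ZMod (dp d)) → ZMod (dp d) :=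
    fun x y => ∑ i, ∑ j, L (B (b i) (b j)) * x i * y j
  have hC : ∀ x y, C x y = ∑ i, ∑ j, L (B (b i) (b j)) * x i * y j := fun _ _ => rfl
  have C_add_left : ∀ x y z, C (x + y) z = C x z + C y z := by
    intro x y z
    simp only [hC, ← Finset.sum_add_distrib, Pi.add_apply]
    exact Finset.sum_congr rfl fun i _ => Finset.sum_congr rfl fun j _ => by ring
  have C_symm : ∀ x y, C x y = C y x := by
    intro x y
    rw [hC, hC, Finset.sum_comm]
    exact Finset.sum_congr rfl fun i _ => Finset.sum_congr rfl fun j _ => by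
      rw [hB (b j) (b i)]; ring
  have C_add_right : ∀ x y z, C x (y + z) = C x y + C x z := by
    intro x y z
    rw [C_symm, C_add_left, C_symm y, C_symm z]
  have two_C : ∀ x z, (∀ i, red d (z i) = 0) → 2 * C x z = 0 := by
    intro x z hz
    rw [hC, Finset.mul_sum]
    refine Finset.sum_eq_zero fun i _ => ?_
    rw [Finset.mul_sum]
    refine Finset.sum_eq_zero fun j _ => ?_
    rw [mul_left_comm, two_mul_eq_zero_of_red (hz j), mul_zero]
  have C_self : ∀ z, (∀ i, red d (z i) = 0) → C z z = 0 := by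
    intro z hz
    rw [hC]
    refine Finset.sum_eq_zero fun i _ => Finset.sum_eq_zero fun j _ => ?_
    rw [mul_assoc, mul_eq_zero_of_red (hz i) (hz j), mul_zero]
  let l : W → ι → ZMod (dp d) := fun u i => L (b.repr u i)
  have red_C : ∀ u v, red d (C (l u) (l v)) = B u v := by
    intro u v
    conv_rhs => rw [← b.sum_repr u, ← b.sum_repr v]
    simp only [hC, map_sum, map_mul, hL, l, LinearMap.sum_apply, map_smul, LinearMap.smul_apply,
      smul_eq_mul]
    rw [Finset.sum_comm]
    refine Finset.sum_congr rfl fun i _ => ?_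
    rw [Finset.mul_sum]
    exact Finset.sum_congr rfl fun j _ => by ring
  refine ⟨fun u => C (l u) (l u), fun u v => ?_⟩
  set z : ι → ZMod (dp d) := l (u + v) - (l u + l v) with hz
  have hz0 : ∀ i, red d (z i) = 0 := by
    intro i
    rw [hz, Pi.sub_apply, Pi.add_apply, map_sub, map_add, hL, hL, hL]
    simp
  have hw : l (u + v) = l u + l v + z := by rw [hz]; abel
  have h1 := two_C (l u) z hz0
  have h2 := two_C (l v) z hz0
  have h3 := C_self z hz0
  show C (l (u + v)) (l (u + v)) = C (l u) (l u) + C (l v) (l v) + twice d (B u v)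
  rw [← red_C u v, twice_red, hw]
  simp only [C_add_left, C_add_right]
  rw [C_symm (l v) (l u), C_symm z (l u), C_symm z (l v)]
  linear_combination h1 + h2 + h3

lemma isPrimitiveRoot_zeta (d : ℕ) [NeZero d] : IsPrimitiveRoot (zeta d) d :=
  Complex.isPrimitiveRoot_exp d (NeZero.ne d)

lemma isPrimitiveRoot_tau (d : ℕ) [NeZero d] : IsPrimitiveRoot (tau d) (dp d) := by
  unfold tau dp
  split
  · have h := Complex.isPrimitiveRoot_exp (2 * d) (mul_ne_zero two_ne_zero (NeZero.ne d))
    convert h using 2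
    push_cast
    have := NeZero.ne d
    field_simp
  · next ho =>
    obtain ⟨k, hk⟩ := Nat.not_even_iff_odd.mp ho
    refine (isPrimitiveRoot_zeta d).pow_of_coprime _ ?_
    have h2 : (d + 1) / 2 = k + 1 := by omega
    rw [h2, hk]
    have : 2 * k + 1 = (k + 1) + k := by ring
    rw [this]
    simp

lemma tau_sq (d : ℕ) [NeZero d] : tau d ^ 2 = zeta d := by
  unfold tau
  split
  · rw [← Complex.exp_nat_mul, zeta]
    congr 1
    push_cast
    ring
  · next ho =>
    obtain ⟨k, hk⟩ := Nat.not_even_iff_odd.mp ho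
    have h2 : (d + 1) / 2 * 2 = d + 1 := by omega
    rw [← pow_mul, h2, pow_succ, (isPrimitiveRoot_zeta d).pow_eq_one, one_mul]

/-- The character `t ↦ tau ^ t` of `ZMod d'`. -/
def tauPow (d : ℕ) (t : ZMod (dp d)) : ℂ := tau d ^ t.val

lemma tauPow_natCast (d : ℕ) [NeZero d] (k : ℕ) : tauPow d k = tau d ^ k := by
  rw [tauPow, ZMod.val_natCast]
  exact (pow_eq_pow_mod k (isPrimitiveRoot_tau d).pow_eq_one).symm

lemma tauPow_zero (d : ℕ) [NeZero d] : tauPow d 0 = 1 := by simp [tauPow]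

lemma tauPow_add {d : ℕ} [NeZero d] (s t : ZMod (dp d)) :
    tauPow d (s + t) = tauPow d s * tauPow d t := by
  obtain ⟨a, rfl⟩ := ZMod.natCast_zmod_surjective s
  obtain ⟨b, rfl⟩ := ZMod.natCast_zmod_surjective t
  rw [← Nat.cast_add, tauPow_natCast, tauPow_natCast, tauPow_natCast, pow_add]

lemma tauPow_ne_zero {d : ℕ} [NeZero d] (t : ZMod (dp d)) : tauPow d t ≠ 0 :=
  pow_ne_zero _ ((isPrimitiveRoot_tau d).ne_zero (NeZero.ne _))

lemma tauPow_injective (d : ℕ) [NeZero d] : Function.Injective (tauPow d) := fun s t h =>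
  ZMod.val_injective _ ((isPrimitiveRoot_tau d).pow_inj (ZMod.val_lt s) (ZMod.val_lt t) h)

lemma tauPow_twice {d : ℕ} [NeZero d] (x : ZMod d) : tauPow d (twice d x) = zeta d ^ x.val := by
  have h : twice d x = ((2 * x.val : ℕ) : ZMod (dp d)) := by rw [twice_apply]; push_cast; rfl
  rw [h, tauPow_natCast, pow_mul, tau_sq]

/-- The polarization `(u, v) ↦ p_u · q_v` of the symplectic form. -/
def beta (d n : ℕ) : V d n →ₗ[ZMod d] V d n →ₗ[ZMod d] ZMod d :=
  LinearMap.mk₂ (ZMod d) (fun u v => dotp u.2 v.1)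
    (fun u v w => by simp [dotp, add_mul, Finset.sum_add_distrib])
    (fun c u v => by simp [dotp, Finset.mul_sum, mul_assoc])
    (fun u v w => by simp [dotp, mul_add, Finset.sum_add_distrib])
    (fun c u v => by simp [dotp, Finset.mul_sum, mul_left_comm])

lemma beta_apply {d n : ℕ} (u v : V d n) : beta d n u v = dotp u.2 v.1 := rfl

lemma omegaF_eq {d n : ℕ} (u v : V d n) : omegaF u v = beta d n u v - beta d n v u := rfl

lemma eq_zero_of_omegaF_eq_zero {d n : ℕ} {u : V d n} (h : ∀ v, omegaF u v = 0) : u = 0 := by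
  refine Prod.ext (funext fun k => ?_) (funext fun k => ?_)
  · simpa [omegaF, dotp, Pi.single_apply] using h (0, Pi.single k 1)
  · simpa [omegaF, dotp, Pi.single_apply] using h (Pi.single k 1, 0)

section Heisenberg

variable {d n : ℕ} [NeZero d]

/-- The matrix `tau ^ t • D_u`. -/
def heisMatrix (t : ZMod (dp d)) (u : V d n) : Matrix (Fin n → ZMod d) (Fin n → ZMod d) ℂ :=
  tauPow d t • Dop d n u

lemma heisMatrix_apply (t : ZMod (dp d)) (u : V d n) (r s : Fin n → ZMod d) :
    heisMatrix t u r s = if r = s + u.1 then tauPow d (t + twice d (dotp u.2 s)) else 0 := by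
  simp only [heisMatrix, Matrix.smul_apply, Dop, smul_eq_mul, mul_ite, mul_zero, tauPow_add,
    tauPow_twice]

lemma heisMatrix_zero : heisMatrix (0 : ZMod (dp d)) (0 : V d n) = 1 := by
  ext r s
  rw [heisMatrix_apply, Matrix.one_apply]
  simp [dotp, tauPow_zero]

lemma heisMatrix_mul (t s : ZMod (dp d)) (u v : V d n) :
    heisMatrix t u * heisMatrix s v = heisMatrix (t + s + twice d (beta d n u v)) (u + v) := by
  ext r x
  rw [Matrix.mul_apply, Finset.sum_eq_single (x + v.1)]
  · simp only [heisMatrix_apply, if_true, Prod.fst_add, Prod.snd_add]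
    have hr : r = x + v.1 + u.1 ↔ r = x + (u.1 + v.1) := by rw [add_assoc, add_comm v.1]
    simp only [hr]
    split_ifs
    · rw [← tauPow_add]
      congr 1
      have h1 : dotp u.2 (x + v.1) = dotp u.2 x + beta d n u v := by
        simp [beta_apply, dotp, mul_add, Finset.sum_add_distrib]
      have h2 : dotp (u.2 + v.2) x = dotp u.2 x + dotp v.2 x := by
        simp [dotp, add_mul, Finset.sum_add_distrib]
      rw [h1, h2, map_add, map_add]
      ring
    · rw [zero_mul]
  · intro y _ hy
    rw [heisMatrix_apply s v, if_neg hy, mul_zero]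
  · intro h
    exact absurd (Finset.mem_univ _) h

lemma heisMatrix_injective {t s : ZMod (dp d)} {u v : V d n}
    (h : heisMatrix t u = heisMatrix s v) : t = s ∧ u = v := by
  have entry : ∀ x : Fin n → ZMod d, x + u.1 = x + v.1 ∧
      t + twice d (dotp u.2 x) = s + twice d (dotp v.2 x) := by
    intro x
    have hx := congrFun (congrFun h (x + u.1)) x
    rw [heisMatrix_apply, heisMatrix_apply, if_pos rfl] at hx
    split_ifs at hx with hq
    · exact ⟨hq, tauPow_injective d hx⟩
    · exact absurd hx (tauPow_ne_zero _)
  have hts : t = s := by simpa [dotp] using (entry 0).2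
  refine ⟨hts, Prod.ext (add_left_cancel (entry 0).1) (funext fun k => ?_)⟩
  have hk := (entry (Pi.single k 1)).2
  rw [hts] at hk
  simpa [dotp, Pi.single_apply] using twice_injective d (add_left_cancel hk)

/-- The matrix `tau ^ t • D_u` as a unit. -/
def heisUnit (t : ZMod (dp d)) (u : V d n) : (Matrix (Fin n → ZMod d) (Fin n → ZMod d) ℂ)ˣ where
  val := heisMatrix t u
  inv := heisMatrix (-t + twice d (beta d n u u)) (-u)
  val_inv := by
    rw [heisMatrix_mul, ← heisMatrix_zero]
    congr 1 <;> simp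
  inv_val := by
    rw [heisMatrix_mul, ← heisMatrix_zero]
    congr 1 <;> simp

lemma heisUnit_mul (t s : ZMod (dp d)) (u v : V d n) :
    heisUnit t u * heisUnit s v = heisUnit (t + s + twice d (beta d n u v)) (u + v) :=
  Units.ext (heisMatrix_mul t s u v)

lemma heisUnit_zero : heisUnit (0 : ZMod (dp d)) (0 : V d n) = 1 := Units.ext heisMatrix_zero

lemma heisUnit_natCast (k : ℕ) : heisUnit (k : ZMod (dp d)) (0 : V d n) = heisUnit 1 0 ^ k := by
  induction k with
  | zero => rw [Nat.cast_zero, heisUnit_zero, pow_zero]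
  | succ k ih => rw [pow_succ, ← ih, heisUnit_mul]; simp

lemma heisUnit_mem (t : ZMod (dp d)) (u : V d n) : heisUnit t u ∈ Pgrp d n := by
  have h : heisUnit t u = heisUnit 1 0 ^ t.val * heisUnit 0 u := by
    rw [← heisUnit_natCast, heisUnit_mul]; simp
  rw [h]
  refine (Pgrp d n).mul_mem ((Pgrp d n).pow_mem (Subgroup.subset_closure (Or.inl ?_)) _)
    (Subgroup.subset_closure (Or.inr ⟨u, ?_⟩))
  · have h1 : tauPow d 1 = tau d := by simpa using tauPow_natCast d 1
    have h0 : Dop d n 0 = 1 := by simpa [heisMatrix, tauPow_zero] using heisMatrix_zero (d := d)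
    change heisMatrix 1 0 = _
    rw [heisMatrix, h1, h0]
  · change heisMatrix 0 u = _
    rw [heisMatrix, tauPow_zero, one_smul]

lemma exists_heisUnit_eq {x : (Matrix (Fin n → ZMod d) (Fin n → ZMod d) ℂ)ˣ}
    (hx : x ∈ Pgrp d n) : ∃ (t : ZMod (dp d)) (u : V d n), heisUnit t u = x := by
  induction hx using Subgroup.closure_induction with
  | mem x hx =>
    rcases hx with hx | ⟨u, hx⟩
    · refine ⟨1, 0, Units.ext ?_⟩
      have h1 : tauPow d 1 = tau d := by simpa using tauPow_natCast d 1
      have h0 : Dop d n 0 = 1 := by simpa [heisMatrix, tauPow_zero] using heisMatrix_zero (d := d)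
      rw [hx, ← h0, ← h1]
      rfl
    · refine ⟨0, u, Units.ext ?_⟩
      change heisMatrix 0 u = _
      rw [hx, heisMatrix, tauPow_zero, one_smul]
  | one => exact ⟨0, 0, heisUnit_zero⟩
  | mul x y _ _ hx hy =>
    obtain ⟨t, u, rfl⟩ := hx
    obtain ⟨s, v, rfl⟩ := hy
    exact ⟨_, _, (heisUnit_mul t s u v).symm⟩
  | inv x _ hx =>
    obtain ⟨t, u, rfl⟩ := hx
    exact ⟨-t + twice d (beta d n u u), -u, Units.ext rfl⟩

/-- The element `tau ^ t • D_u` of `P'`. -/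
def heis (t : ZMod (dp d)) (u : V d n) : Pgrp d n := ⟨heisUnit t u, heisUnit_mem t u⟩

lemma heis_mul (t s : ZMod (dp d)) (u v : V d n) :
    heis t u * heis s v = heis (t + s + twice d (beta d n u v)) (u + v) :=
  Subtype.ext (heisUnit_mul t s u v)

lemma heis_inj {t s : ZMod (dp d)} {u v : V d n} : heis t u = heis s v ↔ t = s ∧ u = v :=
  ⟨fun h => heisMatrix_injective (congrArg matVal h), fun ⟨h, h'⟩ => h ▸ h' ▸ rfl⟩

lemma exists_heis_eq (g : Pgrp d n) : ∃ (t : ZMod (dp d)) (u : V d n), heis t u = g := by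
  obtain ⟨t, u, h⟩ := exists_heisUnit_eq g.2
  exact ⟨t, u, Subtype.ext h⟩

lemma matVal_heis (t : ZMod (dp d)) (u : V d n) : matVal (heis t u) = tauPow d t • Dop d n u := rfl

lemma matVal_injective : Function.Injective (matVal (d := d) (n := n)) :=
  fun _ _ h => Subtype.ext (Units.ext h)

lemma eq_heis_of_matVal_eq_Delta {g : Pgrp d n} {v : V (dp d) n} (h : matVal g = Delta d n v) :
    g = heis (dotp v.1 v.2) (reduceV d n v) :=
  matVal_injective h

lemma heis_mul_heis_zero_left (t s : ZMod (dp d)) (u : V d n) :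
    heis t 0 * heis s u = heis (t + s) u := by
  rw [heis_mul]; simp

/-- The exponent of `tau` in an element of `P'`. -/
def phase (g : Pgrp d n) : ZMod (dp d) := (exists_heis_eq g).choose

/-- The class in `V` of an element of `P'`. -/
def vec (g : Pgrp d n) : V d n := (exists_heis_eq g).choose_spec.choose

lemma heis_phase_vec (g : Pgrp d n) : heis (phase g) (vec g) = g :=
  (exists_heis_eq g).choose_spec.choose_spec

@[simp] lemma phase_heis (t : ZMod (dp d)) (u : V d n) : phase (heis t u) = t :=
  (heis_inj.mp (heis_phase_vec (heis t u))).1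

@[simp] lemma vec_heis (t : ZMod (dp d)) (u : V d n) : vec (heis t u) = u :=
  (heis_inj.mp (heis_phase_vec (heis t u))).2

lemma vec_mul (g h : Pgrp d n) : vec (g * h) = vec g + vec h := by
  obtain ⟨t, u, rfl⟩ := exists_heis_eq g
  obtain ⟨s, v, rfl⟩ := exists_heis_eq h
  rw [heis_mul, vec_heis, vec_heis, vec_heis]

lemma mem_center_iff (g : Pgrp d n) :
    g ∈ Subgroup.center (Pgrp d n) ↔ ∃ t : ZMod (dp d), g = heis t 0 := by
  constructor
  · intro hg
    obtain ⟨t, u, rfl⟩ := exists_heis_eq g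
    refine ⟨t, heis_inj.mpr ⟨rfl, eq_zero_of_omegaF_eq_zero fun v => ?_⟩⟩
    have h := Subgroup.mem_center_iff.mp hg (heis 0 v)
    rw [heis_mul, heis_mul, heis_inj] at h
    have h' : twice d (beta d n v u) = twice d (beta d n u v) := by simpa using h.1
    rw [omegaF_eq, twice_injective d h', sub_self]
  · rintro ⟨t, rfl⟩
    rw [Subgroup.mem_center_iff]
    intro g
    obtain ⟨s, u, rfl⟩ := exists_heis_eq g
    rw [heis_mul, heis_mul, heis_inj]
    simp [add_comm]

/-- The automorphism `tau ^ t • D_u ↦ tau ^ (t + f u) • D_(ψ u)` of `P'`. -/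
def heisAut (f : V d n → ZMod (dp d)) (ψ : V d n ≃ₗ[ZMod d] V d n)
    (hf : ∀ u v, f (u + v) + twice d (beta d n u v) =
      f u + f v + twice d (beta d n (ψ u) (ψ v))) : MulAut (Pgrp d n) where
  toFun g := heis (phase g + f (vec g)) (ψ (vec g))
  invFun g := heis (phase g - f (ψ.symm (vec g))) (ψ.symm (vec g))
  left_inv g := by simp [heis_phase_vec]
  right_inv g := by simp [heis_phase_vec]
  map_mul' g h := by
    obtain ⟨t, u, rfl⟩ := exists_heis_eq g
    obtain ⟨s, v, rfl⟩ := exists_heis_eq h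
    simp only [heis_mul, phase_heis, vec_heis, map_add, heis_inj, and_true]
    linear_combination hf u v

lemma heisAut_heis (f : V d n → ZMod (dp d)) (ψ : V d n ≃ₗ[ZMod d] V d n) (hf)
    (t : ZMod (dp d)) (u : V d n) : heisAut f ψ hf (heis t u) = heis (t + f u) (ψ u) := by
  change heis (phase (heis t u) + f (vec (heis t u))) (ψ (vec (heis t u))) = _
  rw [phase_heis, vec_heis]

lemma heisAut_mem (f : V d n → ZMod (dp d)) (ψ : V d n ≃ₗ[ZMod d] V d n) (hf) :
    heisAut f ψ hf ∈ PClGrp d n := by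
  intro z hz
  obtain ⟨t, rfl⟩ := (mem_center_iff z).mp hz
  have h0 : f 0 = 0 := by simpa using hf 0 0
  rw [heisAut_heis, h0, add_zero, map_zero]

lemma PClGrp_apply_heis {γ : MulAut (Pgrp d n)} (hγ : γ ∈ PClGrp d n) (t : ZMod (dp d))
    (u : V d n) : γ (heis t u) = heis (t + phase (γ (heis 0 u))) (vec (γ (heis 0 u))) := by
  have h : heis t u = heis t 0 * heis 0 u := by rw [heis_mul_heis_zero_left, add_zero]
  rw [h, map_mul, hγ _ ((mem_center_iff _).mpr ⟨t, rfl⟩)]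
  conv_lhs => rw [← heis_phase_vec (γ (heis 0 u))]
  rw [heis_mul_heis_zero_left]

lemma vec_PClGrp_apply {γ : MulAut (Pgrp d n)} (hγ : γ ∈ PClGrp d n) (g : Pgrp d n) :
    vec (γ g) = vec (γ (heis 0 (vec g))) := by
  conv_lhs => rw [← heis_phase_vec g, PClGrp_apply_heis hγ, vec_heis]

/-- The additive map on `V` induced by a projective Clifford automorphism. -/
def inducedLin (γ : PClGrp d n) : V d n →ₗ[ZMod d] V d n :=
  AddMonoidHom.toZModLinearMap d
    (AddMonoidHom.mk' (fun u => vec ((γ : MulAut (Pgrp d n)) (heis 0 u))) fun u v => by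
      rw [← vec_mul, ← map_mul, heis_mul, vec_PClGrp_apply γ.2 (heis (0 + 0 + _) (u + v)),
        vec_heis])

lemma inducedLin_apply (γ : PClGrp d n) (u : V d n) :
    inducedLin γ u = vec ((γ : MulAut (Pgrp d n)) (heis 0 u)) := rfl

lemma vec_apply (γ : PClGrp d n) (g : Pgrp d n) :
    vec ((γ : MulAut (Pgrp d n)) g) = inducedLin γ (vec g) := vec_PClGrp_apply γ.2 g

lemma inducedLin_mul (γ δ : PClGrp d n) : inducedLin (γ * δ) = inducedLin γ ∘ₗ inducedLin δ := by
  refine LinearMap.ext fun u => ?_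
  rw [LinearMap.comp_apply, inducedLin_apply δ, ← vec_apply]
  rfl

lemma inducedLin_one : inducedLin (1 : PClGrp d n) = LinearMap.id :=
  LinearMap.ext fun u => vec_heis 0 u

lemma PClGrp_apply_heis_eq (γ : PClGrp d n) (t : ZMod (dp d)) (u : V d n) :
    (γ : MulAut (Pgrp d n)) (heis t u) =
      heis (t + phase ((γ : MulAut (Pgrp d n)) (heis 0 u))) (inducedLin γ u) :=
  PClGrp_apply_heis γ.2 t u

lemma phase_PClGrp_add (γ : PClGrp d n) (u v : V d n) :
    phase ((γ : MulAut (Pgrp d n)) (heis 0 (u + v))) + twice d (beta d n u v) =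
      phase ((γ : MulAut (Pgrp d n)) (heis 0 u)) + phase ((γ : MulAut (Pgrp d n)) (heis 0 v)) +
        twice d (beta d n (inducedLin γ u) (inducedLin γ v)) := by
  have h := congrArg (γ : MulAut (Pgrp d n)) (heis_mul 0 0 u v)
  rw [map_mul, PClGrp_apply_heis_eq γ 0 u, PClGrp_apply_heis_eq γ 0 v,
    PClGrp_apply_heis_eq γ _ (u + v), heis_mul, heis_inj] at h
  linear_combination -h.1

lemma omegaF_inducedLin (γ : PClGrp d n) (u v : V d n) :
    omegaF (inducedLin γ u) (inducedLin γ v) = omegaF u v := by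
  apply twice_injective d
  have h1 := phase_PClGrp_add γ u v
  have h2 := phase_PClGrp_add γ v u
  rw [add_comm v u] at h2
  rw [omegaF_eq, omegaF_eq, map_sub, map_sub]
  linear_combination h2 - h1

/-- The linear automorphism of `V` induced by a projective Clifford automorphism. -/
def inducedEquiv (γ : PClGrp d n) : V d n ≃ₗ[ZMod d] V d n :=
  LinearEquiv.ofLinearMap (inducedLin γ) (inducedLin γ⁻¹)
    (by rw [← inducedLin_mul, mul_inv_cancel, inducedLin_one])
    (by rw [← inducedLin_mul, inv_mul_cancel, inducedLin_one])

/-- The projection `PCl' → Sp(V, omega)`. -/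
def toSp (d n : ℕ) [NeZero d] : PClGrp d n →* SpGrp d n where
  toFun γ := ⟨inducedEquiv γ, omegaF_inducedLin γ⟩
  map_one' := Subtype.ext (LinearEquiv.toLinearMap_injective inducedLin_one)
  map_mul' γ δ := Subtype.ext (LinearEquiv.toLinearMap_injective (inducedLin_mul γ δ))

lemma toSp_apply (γ : PClGrp d n) (u : V d n) :
    (toSp d n γ : V d n ≃ₗ[ZMod d] V d n) u = inducedLin γ u := rfl

lemma toSp_surjective : Function.Surjective (toSp d n) := by
  intro ψ
  obtain ⟨ψ, hψ⟩ := ψ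
  obtain ⟨f, hf⟩ := exists_quadratic_refinement
    ((Pi.basisFun (ZMod d) (Fin n)).prod (Pi.basisFun (ZMod d) (Fin n)))
    ((beta d n).compl₁₂ (ψ : V d n →ₗ[ZMod d] V d n) (ψ : V d n →ₗ[ZMod d] V d n) - beta d n)
    (fun u v => by
      have h := hψ u v
      rw [omegaF_eq, omegaF_eq] at h
      simp only [LinearMap.sub_apply, LinearMap.compl₁₂_apply, LinearEquiv.coe_coe]
      linear_combination h)
  have hf' : ∀ u v, f (u + v) + twice d (beta d n u v) =
      f u + f v + twice d (beta d n (ψ u) (ψ v)) := by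
    intro u v
    rw [hf, LinearMap.sub_apply, LinearMap.sub_apply, map_sub, LinearMap.compl₁₂_apply,
      LinearEquiv.coe_coe]
    ring
  refine ⟨⟨heisAut f ψ hf', heisAut_mem f ψ hf'⟩, Subtype.ext (LinearEquiv.ext fun u => ?_)⟩
  rw [toSp_apply, inducedLin_apply, heisAut_heis, vec_heis]

/-- The automorphism `tau ^ t • D_u ↦ zeta ^ (μ u) • tau ^ t • D_u` of `P'`. -/
def functionalAut (μ : V d n →ₗ[ZMod d] ZMod d) : PClGrp d n :=
  ⟨heisAut (fun u => twice d (μ u)) (LinearEquiv.refl _ _) (by simp), heisAut_mem _ _ _⟩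

lemma functionalAut_heis (μ : V d n →ₗ[ZMod d] ZMod d) (t : ZMod (dp d)) (u : V d n) :
    (functionalAut μ : MulAut (Pgrp d n)) (heis t u) = heis (t + twice d (μ u)) u :=
  heisAut_heis (fun u => twice d (μ u)) (LinearEquiv.refl _ _) (by simp) t u

lemma PClGrp_ext {γ δ : PClGrp d n}
    (h : ∀ t u, (γ : MulAut (Pgrp d n)) (heis t u) = (δ : MulAut (Pgrp d n)) (heis t u)) :
    γ = δ := by
  refine Subtype.ext (MulEquiv.ext fun g => ?_)
  obtain ⟨t, u, rfl⟩ := exists_heis_eq g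
  exact h t u

/-- The embedding `V* → PCl'`. -/
def ofFunctional (d n : ℕ) [NeZero d] :
    Multiplicative (V d n →ₗ[ZMod d] ZMod d) →* PClGrp d n where
  toFun μ := functionalAut μ.toAdd
  map_one' := PClGrp_ext fun t u => by
    rw [functionalAut_heis]
    simp
  map_mul' μ ν := PClGrp_ext fun t u => by
    rw [functionalAut_heis, Subgroup.coe_mul, MulAut.mul_apply, functionalAut_heis,
      functionalAut_heis, toAdd_mul, LinearMap.add_apply, map_add]
    congr 1
    ring

lemma ofFunctional_heis (μ : V d n →ₗ[ZMod d] ZMod d) (t : ZMod (dp d)) (u : V d n) :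
    (ofFunctional d n (Multiplicative.ofAdd μ) : MulAut (Pgrp d n)) (heis t u) =
      heis (t + twice d (μ u)) u := functionalAut_heis μ t u

lemma ofFunctional_injective : Function.Injective (ofFunctional d n) := by
  intro μ ν h
  refine Multiplicative.toAdd.injective (LinearMap.ext fun u => twice_injective d ?_)
  have hu := congrArg (fun γ : PClGrp d n => (γ : MulAut (Pgrp d n)) (heis 0 u)) h
  have hu' := (functionalAut_heis μ.toAdd 0 u).symm.trans
    (hu.trans (functionalAut_heis ν.toAdd 0 u))
  exact add_left_cancel (heis_inj.mp hu').1

lemma range_ofFunctional : (ofFunctional d n).range = (toSp d n).ker := by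
  ext γ
  rw [MonoidHom.mem_ker]
  constructor
  · rintro ⟨μ, rfl⟩
    refine Subtype.ext (LinearEquiv.ext fun u => ?_)
    rw [toSp_apply, inducedLin_apply]
    exact (congrArg vec (ofFunctional_heis μ.toAdd 0 u)).trans (vec_heis _ _)
  · intro h
    have hγ : ∀ u, inducedLin γ u = u := fun u => by rw [← toSp_apply, h]; rfl
    let f : V d n →+ ZMod (dp d) :=
      AddMonoidHom.mk' (fun u => phase ((γ : MulAut (Pgrp d n)) (heis 0 u))) fun u v => by
        have h := phase_PClGrp_add γ u v
        rw [hγ, hγ] at h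
        exact add_right_cancel h
    have hf : ∀ u, ∃ x, twice d x = f u := fun u => exists_twice_eq (by
      rw [← map_nsmul, ← Nat.cast_smul_eq_nsmul (ZMod d), ZMod.natCast_self, zero_smul, map_zero])
    choose m hm using hf
    let μ : V d n →ₗ[ZMod d] ZMod d := AddMonoidHom.toZModLinearMap d
      (AddMonoidHom.mk' m fun u v => twice_injective d (by rw [map_add, hm, hm, hm, map_add]))
    refine ⟨Multiplicative.ofAdd μ, PClGrp_ext fun t u => ?_⟩
    rw [ofFunctional_heis, PClGrp_apply_heis_eq, hγ]
    exact congrArg (fun s => heis (t + s) u) (hm u)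

lemma reduceV_liftV (u : V d n) : reduceV d n (liftV d n u) = u :=
  Prod.ext (funext fun k => red_natCast_val d (u.1 k)) (funext fun k => red_natCast_val d (u.2 k))

lemma Delta_eq (v : V (dp d) n) :
    Delta d n v = tauPow d (dotp v.1 v.2) • Dop d n (reduceV d n v) := rfl

end Heisenberg

theorem structure_theorem (d n : ℕ) [NeZero d] (hd : 2 ≤ d) (hn : 1 ≤ n) :
    ∃ (π : ↥(PClGrp d n) →* ↥(SpGrp d n))
      (i : Multiplicative (V d n →ₗ[ZMod d] ZMod d) →* ↥(PClGrp d n)),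
      Function.Surjective π ∧
      (∀ γ : ↥(PClGrp d n), ∀ u : V d n, ∃ t : ZMod (dp d),
        ∀ g : ↥(Pgrp d n), matVal g = Delta d n (liftV d n u) →
          matVal ((γ : MulAut ↥(Pgrp d n)) g)
            = tau d ^ t.val •
                Delta d n (liftV d n ((π γ : V d n ≃ₗ[ZMod d] V d n) u))) ∧
      Function.Injective i ∧
      (∀ (mu : V d n →ₗ[ZMod d] ZMod d) (v : V (dp d) n) (g : ↥(Pgrp d n)),
        matVal g = Delta d n v →
          matVal ((i (Multiplicative.ofAdd mu) : MulAut ↥(Pgrp d n)) g)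
            = zeta d ^ (mu (reduceV d n v)).val • Delta d n v) ∧
      i.range = π.ker := by
  refine ⟨toSp d n, ofFunctional d n, toSp_surjective, fun γ u => ?_, ofFunctional_injective,
    fun μ v g hg => ?_, range_ofFunctional⟩
  · refine ⟨dotp (liftV d n u).1 (liftV d n u).2 + phase ((γ : MulAut (Pgrp d n)) (heis 0 u)) -
      dotp (liftV d n (inducedLin γ u)).1 (liftV d n (inducedLin γ u)).2, fun g hg => ?_⟩
    rw [eq_heis_of_matVal_eq_Delta hg, PClGrp_apply_heis_eq, matVal_heis, toSp_apply, Delta_eq,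
      reduceV_liftV, reduceV_liftV, ← tauPow, smul_smul, ← tauPow_add, sub_add_cancel]
  · rw [eq_heis_of_matVal_eq_Delta hg, ofFunctional_heis, matVal_heis, Delta_eq, smul_smul,
      ← tauPow_twice, ← tauPow_add, add_comm]

end PaperPCl
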